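/- Let δ = (1+√5)/2, let α be the unique real root greater than 1 of x³ − x − 1, and let a = (1+α)/(−α² + 3α + 1). Then for all positive integers n, m₁ and all integers m > m₁, δ^{2n} ≠ 5 · a² · α^{2m₁} · (α^{m−m₁} − 1)². -/

import Mathlib

open IntermediateField Polynomial in
theorem sqrt5_not_mem (α : ℝ) (hαroot : α ^ 3 = α + 1) : Real.sqrt 5 ∉ ℚ⟮α⟯ := by
  intro h
  have hmon : (X ^ 3 - X - 1 : ℚ[X]).Monic := by monicity!
  have hdeg : (X ^ 3 - X - 1 : ℚ[X]).natDegree = 3 := by compute_degree!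
  have hev : aeval α (X ^ 3 - X - 1 : ℚ[X]) = 0 := by
    simp only [map_sub, map_pow, aeval_X, map_one]; linarith
  have hint : IsIntegral ℚ α := ⟨_, hmon, by simpa [aeval_def] using hev⟩
  have hmin : X ^ 3 - X - 1 = minpoly ℚ α :=
    minpoly.eq_of_irreducible_of_monic (X_pow_sub_X_sub_one_irreducible_rat (by norm_num)) hev hmon
  have hfin : Module.finrank ℚ ℚ⟮α⟯ = 3 := by
    rw [adjoin.finrank hint, ← hmin, hdeg]
  have : FiniteDimensional ℚ ℚ⟮α⟯ := adjoin.finiteDimensional hint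
  let s : ℚ⟮α⟯ := ⟨Real.sqrt 5, h⟩
  have hs2 : s ^ 2 = 5 := by
    apply Subtype.ext
    change (Real.sqrt 5) ^ 2 = 5
    norm_num
  have hdvd : (minpoly ℚ s).natDegree ∣ 3 := by
    rw [← hfin]; exact minpoly.degree_dvd (Algebra.IsIntegral.isIntegral s)
  have hq : (minpoly ℚ s).natDegree ≤ 2 := by
    have h2 : (X ^ 2 - C 5 : ℚ[X]).natDegree = 2 := natDegree_X_pow_sub_C
    rw [← h2]
    apply natDegree_le_of_dvd
    · apply minpoly.dvd
      simp [hs2]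
    · intro h0; rw [h0] at h2; simp at h2
  have h1 : (minpoly ℚ s).natDegree = 1 := by
    rcases (Nat.dvd_prime Nat.prime_three).1 hdvd with h | h <;> omega
  obtain ⟨q, hq⟩ := minpoly.natDegree_eq_one_iff.1 h1
  have hirr : Irrational (Real.sqrt 5) := by
    simpa using (show Nat.Prime 5 by norm_num).irrational_sqrt
  refine hirr ⟨q, ?_⟩
  have := congrArg (fun x : ℚ⟮α⟯ => (x : ℝ)) hq
  simpa [s] using this

open IntermediateField in
/-- Let `δ = (1+√5)/2`, let `α` be the real root greater than `1` of `x³ - x - 1`, and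
`a = (1+α)/(-α² + 3α + 1)`. Then for all positive integers `n`, `m₁` and all integers
`m > m₁`, `δ^(2n) ≠ 5·a²·α^(2m₁)·(α^(m-m₁) - 1)²`. -/
theorem lambda₂_ne_zero (δ α a : ℝ) (hδ : δ = (1 + Real.sqrt 5) / 2)
    (hαroot : α ^ 3 = α + 1) (hα : 1 < α)
    (ha : a = (1 + α) / (-α ^ 2 + 3 * α + 1)) :
    ∀ n m₁ m : ℕ, 0 < n → 0 < m₁ → m₁ < m →
      δ ^ (2 * n) ≠ 5 * a ^ 2 * α ^ (2 * m₁) * (α ^ (m - m₁) - 1) ^ 2 := by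
  intro n m₁ m hn _ _ heq
  apply sqrt5_not_mem α hαroot
  have hαm : α ∈ ℚ⟮α⟯ := mem_adjoin_simple_self ℚ α
  have hnat : ∀ k : ℕ, (k : ℝ) ∈ ℚ⟮α⟯ := fun k => _root_.natCast_mem _ k
  have h1 : (1 : ℝ) ∈ ℚ⟮α⟯ := one_mem _
  have h5 : (5 : ℝ) ∈ ℚ⟮α⟯ := by exact_mod_cast hnat 5
  have h2 : (2 : ℝ) ∈ ℚ⟮α⟯ := by exact_mod_cast hnat 2
  have h3 : (3 : ℝ) ∈ ℚ⟮α⟯ := by exact_mod_cast hnat 3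
  have ham : a ∈ ℚ⟮α⟯ := by
    rw [ha]
    exact div_mem (add_mem h1 hαm)
      (add_mem (add_mem (neg_mem (pow_mem hαm 2)) (mul_mem h3 hαm)) h1)
  have hr : δ ^ (2 * n) ∈ ℚ⟮α⟯ := by
    rw [heq]
    exact mul_mem (mul_mem (mul_mem h5 (pow_mem ham 2)) (pow_mem hαm _))
      (pow_mem (sub_mem (pow_mem hαm _) h1) 2)
  have hfib : ∀ k : ℕ, δ ^ (k + 1) = δ * Nat.fib (k + 1) + Nat.fib k := by
    have hsq : δ ^ 2 = δ + 1 := by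
      rw [hδ]
      have := Real.sq_sqrt (show (0 : ℝ) ≤ 5 by norm_num)
      linear_combination this / 4
    intro k
    induction k with
    | zero => simp
    | succ k ih =>
      rw [pow_succ, ih, Nat.fib_add_two]
      push_cast
      linear_combination (Nat.fib (k + 1) : ℝ) * hsq
  obtain ⟨k, hk⟩ : ∃ k, 2 * n = k + 1 := ⟨2 * n - 1, by omega⟩
  rw [hk, hfib] at hr
  have hF : (Nat.fib (k + 1) : ℝ) ≠ 0 := by
    exact_mod_cast (Nat.fib_pos.2 (Nat.succ_pos k)).ne'
  have hs : Real.sqrt 5 =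
      2 * ((δ * Nat.fib (k + 1) + Nat.fib k - Nat.fib k) / Nat.fib (k + 1)) - 1 := by
    rw [add_sub_cancel_right, mul_div_cancel_right₀ _ hF, hδ]; ring
  rw [hs]
  exact sub_mem (mul_mem h2 (div_mem (sub_mem hr (hnat _)) (hnat _))) h1
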